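/- The potential $\mathcal{F}_{2,5}$ (as above) satisfies the WDVV associativity equations with respect to the flat metric $\eta$ determined by $\eta_{\alpha\beta} = \partial_2\partial_\alpha\partial_\beta \mathcal{F}_{2,5}$: for all indices $1 \le \alpha,\beta,\sigma,\gamma \le 5$, $\sum_{\nu,\mu} \frac{\partial^3 \mathcal{F}_{2,5}}{\partial t_\sigma \partial t_\gamma \partial t_\nu} \eta^{\nu\mu} \frac{\partial^3 \mathcal{F}_{2,5}}{\partial t_\mu \partial t_\alpha \partial t_\beta} = \sum_{\nu,\mu} \frac{\partial^3 \mathcal{F}_{2,5}}{\partial t_\alpha \partial t_\gamma \partial t_\nu} \eta^{\nu\mu} \frac{\partial^3 \mathcal{F}_{2,5}}{\partial t_\mu \partial t_\sigma \partial t_\beta}$ as rational functions on $\{t_5 \ne 0\}$. -/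

import Mathlib

/-- Partial derivative in the `i`-th coordinate direction. -/
noncomputable def pd {n : ℕ} (i : Fin n) (f : (Fin n → ℝ) → ℝ) : (Fin n → ℝ) → ℝ :=
  fun x => fderiv ℝ f x (Pi.single i 1)

/-- The `B_{2,5}` Dubrovin–Frobenius potential `𝓕_{2,5}(t_1, …, t_5)`. -/
noncomputable def F25 : (Fin 5 → ℝ) → ℝ := fun t =>
  (t 4) ^ 6 / 10 + t 0 * t 3 * (t 4) ^ 3 / 6 + (t 0) ^ 2 * t 2 * t 4 / 16
    + t 1 * t 2 * t 4 / 2 + (t 0) ^ 5 / 7680 + t 0 * (t 1) ^ 2 / 16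
    + (t 0) ^ 2 * (t 3) ^ 2 / 192 + t 1 * (t 3) ^ 2 / 24
    + (t 2) ^ 2 * t 3 / (24 * t 4) - t 2 * (t 3) ^ 3 / (216 * (t 4) ^ 2)
    + (t 3) ^ 5 / (4320 * (t 4) ^ 3)

/-- The constant flat metric `η_{αβ} = ∂³𝓕_{2,5}/∂t_2∂t_α∂t_β`. -/
noncomputable def eta25 : Matrix (Fin 5) (Fin 5) ℝ :=
  !![0, 1/8, 0, 0, 0;
     1/8, 0, 0, 0, 0;
     0, 0, 0, 0, 1/2;
     0, 0, 0, 1/12, 0;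
     0, 0, 1/2, 0, 0]

open Topology

section PartialDerivatives

variable {n : ℕ} {i : Fin n} {f g : (Fin n → ℝ) → ℝ} {t : Fin n → ℝ}

theorem pd_const (c : ℝ) : pd i (fun _ => c) t = 0 := by
  simp [pd]

theorem pd_coord (j : Fin n) : pd i (fun x => x j) t = if j = i then 1 else 0 := by
  simp [pd, (hasFDerivAt_apply j t).fderiv, Pi.single_apply]

theorem pd_add (hf : DifferentiableAt ℝ f t) (hg : DifferentiableAt ℝ g t) :
    pd i (fun x => f x + g x) t = pd i f t + pd i g t := by
  simp [pd, fderiv_fun_add hf hg]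

theorem pd_sub (hf : DifferentiableAt ℝ f t) (hg : DifferentiableAt ℝ g t) :
    pd i (fun x => f x - g x) t = pd i f t - pd i g t := by
  simp [pd, fderiv_fun_sub hf hg]

theorem pd_mul (hf : DifferentiableAt ℝ f t) (hg : DifferentiableAt ℝ g t) :
    pd i (fun x => f x * g x) t = f t * pd i g t + g t * pd i f t := by
  simp [pd, fderiv_fun_mul hf hg]

theorem pd_pow (hf : DifferentiableAt ℝ f t) (m : ℕ) :
    pd i (fun x => f x ^ m) t = m * f t ^ (m - 1) * pd i f t := by
  simp [pd, fderiv_fun_pow m hf]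

theorem pd_div (hf : DifferentiableAt ℝ f t) (hg : DifferentiableAt ℝ g t) (h : g t ≠ 0) :
    pd i (fun x => f x / g x) t = (g t * pd i f t - f t * pd i g t) / g t ^ 2 := by
  have hinv := hf.hasFDerivAt.mul ((hasDerivAt_inv h).comp_hasFDerivAt t hg.hasFDerivAt)
  have hdiv : (fun x => f x / g x) = f * (Inv.inv ∘ g) := by
    ext x
    simp [div_eq_mul_inv]
  rw [pd, hdiv, hinv.fderiv]
  simp [pd]
  field_simp
  ring

theorem pd_congr (h : f =ᶠ[𝓝 t] g) : pd i f t = pd i g t := by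
  rw [pd, pd, h.fderiv_eq]

end PartialDerivatives

/-- The gradient of `F25` on `{t 4 ≠ 0}`. -/
noncomputable def F25Grad (t : Fin 5 → ℝ) : Fin 5 → ℝ :=
  ![t 3 * t 4 ^ 3 / 6 + t 0 * t 2 * t 4 / 8 + t 0 ^ 4 / 1536 + t 1 ^ 2 / 16 + t 0 * t 3 ^ 2 / 96,
    t 2 * t 4 / 2 + t 0 * t 1 / 8 + t 3 ^ 2 / 24,
    t 0 ^ 2 * t 4 / 16 + t 1 * t 4 / 2 + t 2 * t 3 / (12 * t 4) - t 3 ^ 3 / (216 * t 4 ^ 2),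
    t 0 * t 4 ^ 3 / 6 + t 0 ^ 2 * t 3 / 96 + t 1 * t 3 / 12 + t 2 ^ 2 / (24 * t 4)
      - t 2 * t 3 ^ 2 / (72 * t 4 ^ 2) + t 3 ^ 4 / (864 * t 4 ^ 3),
    3 * t 4 ^ 5 / 5 + t 0 * t 3 * t 4 ^ 2 / 2 + t 0 ^ 2 * t 2 / 16 + t 1 * t 2 / 2
      - t 2 ^ 2 * t 3 / (24 * t 4 ^ 2) + t 2 * t 3 ^ 3 / (108 * t 4 ^ 3)
      - t 3 ^ 5 / (1440 * t 4 ^ 4)]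

/-- The Hessian of `F25` on `{t 4 ≠ 0}`. -/
noncomputable def F25Hess (t : Fin 5 → ℝ) : Matrix (Fin 5) (Fin 5) ℝ :=
  !![t 2 * t 4 / 8 + t 0 ^ 3 / 384 + t 3 ^ 2 / 96, t 1 / 8, t 0 * t 4 / 8, t 4 ^ 3 / 6
    + t 0 * t 3 / 48, t 3 * t 4 ^ 2 / 2 + t 0 * t 2 / 8;
     t 1 / 8, t 0 / 8, t 4 / 2, t 3 / 12, t 2 / 2;
     t 0 * t 4 / 8, t 4 / 2, t 3 / (12 * t 4), t 2 / (12 * t 4) - t 3 ^ 2 / (72 * t 4 ^ 2),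
       t 0 ^ 2 / 16 + t 1 / 2 - t 2 * t 3 / (12 * t 4 ^ 2) + t 3 ^ 3 / (108 * t 4 ^ 3);
     t 4 ^ 3 / 6 + t 0 * t 3 / 48, t 3 / 12, t 2 / (12 * t 4) - t 3 ^ 2 / (72 * t 4 ^ 2),
       t 0 ^ 2 / 96 + t 1 / 12 - t 2 * t 3 / (36 * t 4 ^ 2) + t 3 ^ 3 / (216 * t 4 ^ 3),
       t 0 * t 4 ^ 2 / 2 - t 2 ^ 2 / (24 * t 4 ^ 2) + t 2 * t 3 ^ 2 / (36 * t 4 ^ 3)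
       - t 3 ^ 4 / (288 * t 4 ^ 4);
     t 3 * t 4 ^ 2 / 2 + t 0 * t 2 / 8, t 2 / 2, t 0 ^ 2 / 16 + t 1 / 2
       - t 2 * t 3 / (12 * t 4 ^ 2) + t 3 ^ 3 / (108 * t 4 ^ 3), t 0 * t 4 ^ 2 / 2
       - t 2 ^ 2 / (24 * t 4 ^ 2) + t 2 * t 3 ^ 2 / (36 * t 4 ^ 3) - t 3 ^ 4 / (288 * t 4 ^ 4),
       3 * t 4 ^ 4 + t 0 * t 3 * t 4 + t 2 ^ 2 * t 3 / (12 * t 4 ^ 3)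
       - t 2 * t 3 ^ 3 / (36 * t 4 ^ 4) + t 3 ^ 5 / (360 * t 4 ^ 5)]

/-- The third derivatives of `F25` on `{t 4 ≠ 0}`. -/
noncomputable def F25Third (t : Fin 5 → ℝ) : Fin 5 → Matrix (Fin 5) (Fin 5) ℝ :=
  ![!![t 0 ^ 2 / 128, 0, t 4 / 8, t 3 / 48, t 2 / 8;
     0, 1 / 8, 0, 0, 0;
     t 4 / 8, 0, 0, 0, t 0 / 8;
     t 3 / 48, 0, 0, t 0 / 48, t 4 ^ 2 / 2;
     t 2 / 8, 0, t 0 / 8, t 4 ^ 2 / 2, t 3 * t 4], !![0, 1 / 8, 0, 0, 0;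
     1 / 8, 0, 0, 0, 0;
     0, 0, 0, 0, 1 / 2;
     0, 0, 0, 1 / 12, 0;
     0, 0, 1 / 2, 0, 0], !![t 4 / 8, 0, 0, 0, t 0 / 8;
     0, 0, 0, 0, 1 / 2;
     0, 0, 0, 1 / (12 * t 4), -t 3 / (12 * t 4 ^ 2);
     0, 0, 1 / (12 * t 4), -t 3 / (36 * t 4 ^ 2), -t 2 / (12 * t 4 ^ 2) + t 3 ^ 2 / (36 * t 4 ^ 3);
     t 0 / 8, 1 / 2, -t 3 / (12 * t 4 ^ 2), -t 2 / (12 * t 4 ^ 2) + t 3 ^ 2 / (36 * t 4 ^ 3),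
       t 2 * t 3 / (6 * t 4 ^ 3) - t 3 ^ 3 / (36 * t 4 ^ 4)], !![t 3 / 48, 0, 0, t 0 / 48,
       t 4 ^ 2 / 2;
     0, 0, 0, 1 / 12, 0;
     0, 0, 1 / (12 * t 4), -t 3 / (36 * t 4 ^ 2), -t 2 / (12 * t 4 ^ 2) + t 3 ^ 2 / (36 * t 4 ^ 3);
     t 0 / 48, 1 / 12, -t 3 / (36 * t 4 ^ 2), -t 2 / (36 * t 4 ^ 2) + t 3 ^ 2 / (72 * t 4 ^ 3),
       t 2 * t 3 / (18 * t 4 ^ 3) - t 3 ^ 3 / (72 * t 4 ^ 4);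
     t 4 ^ 2 / 2, 0, -t 2 / (12 * t 4 ^ 2) + t 3 ^ 2 / (36 * t 4 ^ 3), t 2 * t 3 / (18 * t 4 ^ 3)
       - t 3 ^ 3 / (72 * t 4 ^ 4), t 0 * t 4 + t 2 ^ 2 / (12 * t 4 ^ 3)
       - t 2 * t 3 ^ 2 / (12 * t 4 ^ 4) + t 3 ^ 4 / (72 * t 4 ^ 5)], !![t 2 / 8, 0, t 0 / 8,
       t 4 ^ 2 / 2, t 3 * t 4;
     0, 0, 1 / 2, 0, 0;
     t 0 / 8, 1 / 2, -t 3 / (12 * t 4 ^ 2), -t 2 / (12 * t 4 ^ 2) + t 3 ^ 2 / (36 * t 4 ^ 3),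
       t 2 * t 3 / (6 * t 4 ^ 3) - t 3 ^ 3 / (36 * t 4 ^ 4);
     t 4 ^ 2 / 2, 0, -t 2 / (12 * t 4 ^ 2) + t 3 ^ 2 / (36 * t 4 ^ 3), t 2 * t 3 / (18 * t 4 ^ 3)
       - t 3 ^ 3 / (72 * t 4 ^ 4), t 0 * t 4 + t 2 ^ 2 / (12 * t 4 ^ 3)
       - t 2 * t 3 ^ 2 / (12 * t 4 ^ 4) + t 3 ^ 4 / (72 * t 4 ^ 5);
     t 3 * t 4, 0, t 2 * t 3 / (6 * t 4 ^ 3) - t 3 ^ 3 / (36 * t 4 ^ 4), t 0 * t 4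
       + t 2 ^ 2 / (12 * t 4 ^ 3) - t 2 * t 3 ^ 2 / (12 * t 4 ^ 4) + t 3 ^ 4 / (72 * t 4 ^ 5),
       12 * t 4 ^ 3 + t 0 * t 3 - t 2 ^ 2 * t 3 / (4 * t 4 ^ 4) + t 2 * t 3 ^ 3 / (9 * t 4 ^ 5)
       - t 3 ^ 5 / (72 * t 4 ^ 6)]]

theorem eventually_coord_ne_zero {n : ℕ} {j : Fin n} {t : Fin n → ℝ} (ht : t j ≠ 0) :
    ∀ᶠ x in 𝓝 t, x j ≠ 0 :=
  (continuous_apply j).continuousAt.eventually_ne ht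

theorem pd_F25 {t : Fin 5 → ℝ} (ht : t 4 ≠ 0) (k : Fin 5) : pd k F25 t = F25Grad t k := by
  unfold F25
  fin_cases k <;>
  · simp (disch := first | fun_prop (disch := simp [ht]) | simp [ht])
      [pd_const, pd_coord, pd_add, pd_sub, pd_mul, pd_pow, pd_div, F25Grad]
    try field_simp
    try ring

set_option maxHeartbeats 4000000 in
theorem pd_F25Grad {t : Fin 5 → ℝ} (ht : t 4 ≠ 0) (j k : Fin 5) :
    pd j (fun x => F25Grad x k) t = F25Hess t j k := by
  fin_cases k <;> fin_cases j <;>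
  · simp only [F25Grad, F25Hess, Fin.zero_eta, Fin.mk_one, Fin.reduceFinMk, Matrix.of_apply,
      Matrix.cons_val]
    simp (disch := first | fun_prop (disch := simp [ht]) | simp [ht])
      [pd_const, pd_coord, pd_add, pd_sub, pd_mul, pd_pow, pd_div]
    try field_simp
    try ring

set_option maxHeartbeats 20000000 in
theorem pd_F25Hess {t : Fin 5 → ℝ} (ht : t 4 ≠ 0) (i j k : Fin 5) :
    pd i (fun x => F25Hess x j k) t = F25Third t i j k := by
  fin_cases k <;> fin_cases j <;> fin_cases i <;>
  · simp only [F25Hess, F25Third, Fin.zero_eta, Fin.mk_one, Fin.reduceFinMk, Matrix.of_apply,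
      Matrix.cons_val]
    simp (disch := first | fun_prop (disch := simp [ht]) | simp [ht])
      [pd_const, pd_coord, pd_add, pd_sub, pd_mul, pd_pow, pd_div]
    try field_simp
    try ring

theorem pd_pd_F25 {t : Fin 5 → ℝ} (ht : t 4 ≠ 0) (j k : Fin 5) :
    pd j (pd k F25) t = F25Hess t j k := by
  rw [← pd_F25Grad ht]
  exact pd_congr ((eventually_coord_ne_zero ht).mono fun _ hx => pd_F25 hx k)

theorem pd_pd_pd_F25 {t : Fin 5 → ℝ} (ht : t 4 ≠ 0) (i j k : Fin 5) :
    pd i (pd j (pd k F25)) t = F25Third t i j k := by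
  rw [← pd_F25Hess ht]
  exact pd_congr ((eventually_coord_ne_zero ht).mono fun _ hx => pd_pd_F25 hx j k)

theorem eta25_inv : eta25⁻¹ =
    !![0, 8, 0, 0, 0;
       8, 0, 0, 0, 0;
       0, 0, 0, 0, 2;
       0, 0, 0, 12, 0;
       0, 0, 2, 0, 0] := by
  refine Matrix.inv_eq_right_inv ?_
  ext i j
  fin_cases i <;> fin_cases j <;> simp [eta25, Matrix.mul_apply, Fin.sum_univ_five]

theorem sum_mul_eta25_inv_mul (u v : Fin 5 → ℝ) :
    ∑ ν, ∑ μ, u ν * eta25⁻¹ ν μ * v μ =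
      8 * (u 0 * v 1 + u 1 * v 0) + 2 * (u 2 * v 4 + u 4 * v 2) + 12 * (u 3 * v 3) := by
  simp [eta25_inv, Fin.sum_univ_five]
  ring

/-- The associativity equation for the indices `σ, α, γ, β`, with the contraction by `η⁻¹`
written out. -/
def F25Assoc (t : Fin 5 → ℝ) (σ α γ β : Fin 5) : Prop :=
  8 * (F25Third t σ γ 0 * F25Third t 1 α β + F25Third t σ γ 1 * F25Third t 0 α β) +
      2 * (F25Third t σ γ 2 * F25Third t 4 α β + F25Third t σ γ 4 * F25Third t 2 α β) +
      12 * (F25Third t σ γ 3 * F25Third t 3 α β) =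
    8 * (F25Third t α γ 0 * F25Third t 1 σ β + F25Third t α γ 1 * F25Third t 0 σ β) +
      2 * (F25Third t α γ 2 * F25Third t 4 σ β + F25Third t α γ 4 * F25Third t 2 σ β) +
      12 * (F25Third t α γ 3 * F25Third t 3 σ β)

set_option maxHeartbeats 20000000 in
theorem F25Assoc_of_lt {t : Fin 5 → ℝ} (ht : t 4 ≠ 0) {σ α : Fin 5} (h : σ < α) (γ β : Fin 5) :
    F25Assoc t σ α γ β := by
  unfold F25Assoc
  revert h
  fin_cases σ <;> fin_cases α <;> intro h <;> first | exact absurd h (by decide) | skip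
  all_goals
    fin_cases γ <;> fin_cases β <;>
    · simp only [F25Third, Fin.zero_eta, Fin.mk_one, Fin.reduceFinMk, Matrix.of_apply,
        Matrix.cons_val]
      try field_simp
      try ring

/-- The WDVV associativity equations for `𝓕_{2,5}` with respect to `η` (with `η⁻¹` the
inverse matrix), as identities of functions on `{t_5 ≠ 0}`. -/
theorem stmt7 (α β σ γ : Fin 5) (t : Fin 5 → ℝ) (ht : t 4 ≠ 0) :
    ∑ ν, ∑ μ, pd σ (pd γ (pd ν F25)) t * eta25⁻¹ ν μ * pd μ (pd α (pd β F25)) t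
      = ∑ ν, ∑ μ, pd α (pd γ (pd ν F25)) t * eta25⁻¹ ν μ * pd μ (pd σ (pd β F25)) t := by
  simp only [pd_pd_pd_F25 ht]
  rw [sum_mul_eta25_inv_mul (F25Third t σ γ) (fun μ => F25Third t μ α β),
    sum_mul_eta25_inv_mul (F25Third t α γ) (fun μ => F25Third t μ σ β)]
  rcases lt_trichotomy σ α with h | rfl | h
  · exact F25Assoc_of_lt ht h γ β
  · rfl
  · exact (F25Assoc_of_lt ht h γ β).symm
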